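/- Let 1/2 ≤ δ < 1 be a fixed real constant, fix ε > 0, and for each n set k = ⌈n^{1/3}⌉ and m = ⌊δn⌋ − k. Let G be drawn from 𝓗₂(n,m). Then lim_{n→∞} Pr_G[ Pr_{α∼𝓕₁(n,2k)}[α ∧ G is satisfiable] ≥ 1 − ε ] = 1, where the inner probability is over an independent α. -/

import Mathlib

open Finset Filter

/-- A 2-clause over variables `x_0, …, x_{n-1}`: an (ordered) pair of literals on two
distinct variables, the first literal having the smaller variable index.  A literal is a
pair (variable, polarity).  There are `4 * (n choose 2)` such clauses. -/
abbrev Clause (n : ℕ) := {p : (Fin n × Bool) × (Fin n × Bool) // p.1.1 < p.2.1}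

/-- Value of a literal under a total assignment. -/
def litVal {n : ℕ} (σ : Fin n → Bool) (ℓ : Fin n × Bool) : Bool :=
  if ℓ.2 then σ ℓ.1 else !(σ ℓ.1)

/-- A total assignment satisfies a 2-clause. -/
def clauseSat {n : ℕ} (σ : Fin n → Bool) (C : Clause n) : Prop :=
  litVal σ C.val.1 = true ∨ litVal σ C.val.2 = true

/-- Probability of the event `P` under the uniform distribution on the finite type `Ω`. -/
noncomputable def pr (Ω : Type*) [Fintype Ω] (P : Ω → Prop) : ℝ :=
  (Nat.card {ω : Ω // P ω} : ℝ) / (Fintype.card Ω : ℝ)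

/-- A partial assignment to the variables `x_0, …, x_{n-1}`. -/
abbrev PAssign (n : ℕ) := Fin n → Option Bool

/-- The (two-element) set of variables of a 2-clause. -/
def vars {n : ℕ} (C : Clause n) : Finset (Fin n) := {C.val.1.1, C.val.2.1}

/-- The set of variables assigned by a partial assignment. -/
def support {n : ℕ} (α : PAssign n) : Finset (Fin n) := univ.filter (fun x => (α x).isSome)

/-- Value of a literal under a partial assignment. -/
def plitVal {n : ℕ} (α : PAssign n) (ℓ : Fin n × Bool) : Option Bool :=
  (α ℓ.1).map (fun b => if ℓ.2 then b else !b)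

/-- A partial assignment satisfies a 2-clause. -/
def pClauseSat {n : ℕ} (α : PAssign n) (C : Clause n) : Prop :=
  plitVal α C.val.1 = some true ∨ plitVal α C.val.2 = some true

/-- The set of variables of a 2-CNF (a multiset of clauses). -/
def mvars {n : ℕ} (F : Multiset (Clause n)) : Finset (Fin n) := F.toFinset.biUnion vars

/-- `α ∈ sat(H)`: `α` is an assignment to exactly the variables of `H` satisfying `H`. -/
def satAssign {n : ℕ} (H : Multiset (Clause n)) (α : PAssign n) : Prop :=
  support α = mvars H ∧ ∀ C ∈ H, pClauseSat α C

/-- `F ∧ α` is satisfiable: `α` extends to a total assignment satisfying `F`. -/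
def extendable {n : ℕ} (F : Multiset (Clause n)) (α : PAssign n) : Prop :=
  ∃ σ : Fin n → Bool, (∀ x b, α x = some b → σ x = b) ∧ ∀ C ∈ F, clauseSat σ C

/-- `θ(H,F)`: the fraction of `α ∈ sat(H)` such that `F ∧ α` is satisfiable
(`1` if `H` is unsatisfiable). -/
noncomputable def theta {n : ℕ} (H F : Multiset (Clause n)) : ℝ :=
  if Nat.card {α : PAssign n // satAssign H α} = 0 then 1
  else (Nat.card {α : PAssign n // satAssign H α ∧ extendable F α} : ℝ) /
    (Nat.card {α : PAssign n // satAssign H α} : ℝ)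

/-- Partial assignments assigning exactly `k` variables (`𝓕₁(n,k)` sample space). -/
abbrev PAk (n k : ℕ) := {α : PAssign n // (support α).card = k}


namespace TwoSat

section Deterministic

variable {V : Type*}

/-- The negation of a literal. -/
def neg (a : V × Bool) : V × Bool := (a.1, !a.2)

@[simp] lemma neg_fst (a : V × Bool) : (neg a).1 = a.1 := rfl

@[simp] lemma neg_neg (a : V × Bool) : neg (neg a) = a := by simp [neg]

lemma neg_ne (a : V × Bool) : neg a ≠ a := by
  intro h
  have := congrArg Prod.snd h
  simp [neg] at this

lemma neg_injective : Function.Injective (neg : V × Bool → V × Bool) :=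
  Function.LeftInverse.injective neg_neg

/-- The clauses `¬wᵢ ∨ wᵢ₊₁` expressing the implications along a list of literals. -/
def edges : List (V × Bool) → List (Sym2 (V × Bool))
  | a :: b :: l => s(neg a, b) :: edges (b :: l)
  | _ => []

lemma edges_cons_cons (a b : V × Bool) (l : List (V × Bool)) :
    edges (a :: b :: l) = s(neg a, b) :: edges (b :: l) := rfl

@[simp] lemma edges_singleton (a : V × Bool) : edges [a] = [] := rfl

lemma length_edges_cons (a : V × Bool) (l : List (V × Bool)) :
    (edges (a :: l)).length = l.length := by
  induction l generalizing a with
  | nil => rfl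
  | cons b l ih => simp [edges_cons_cons, ih]

lemma edges_append (l r : List (V × Bool)) (p q : V × Bool) :
    edges ((l ++ [p]) ++ (q :: r)) = edges (l ++ [p]) ++ s(neg p, q) :: edges (q :: r) := by
  induction l with
  | nil => rfl
  | cons x l ih =>
    cases l with
    | nil => rfl
    | cons y l =>
      simp only [List.cons_append, edges_cons_cons] at ih ⊢
      rw [ih]

lemma fst_mem_of_mem_edges {l : List (V × Bool)} {e : Sym2 (V × Bool)} (he : e ∈ edges l)
    {x : V × Bool} (hx : x ∈ e) : x.1 ∈ l.map Prod.fst := by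
  induction l with
  | nil => simp [edges] at he
  | cons a l ih =>
    cases l with
    | nil => simp at he
    | cons b l =>
      rw [edges_cons_cons, List.mem_cons] at he
      rcases he with rfl | he
      · rcases Sym2.mem_iff.1 hx with rfl | rfl <;> simp
      · exact List.mem_cons_of_mem _ (ih he)

lemma nodup_edges {l : List (V × Bool)} (hl : (l.map Prod.fst).Nodup) : (edges l).Nodup := by
  induction l with
  | nil => simp [edges]
  | cons a l ih =>
    cases l with
    | nil => simp
    | cons b l =>
      rw [List.map_cons, List.nodup_cons] at hl
      rw [edges_cons_cons, List.nodup_cons]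
      refine ⟨fun h => hl.1 ?_, ih hl.2⟩
      exact fst_mem_of_mem_edges h (x := neg a) (Sym2.mem_mk_left _ _)

lemma head_notMem_of_mem_edges {a : V × Bool} {l : List (V × Bool)}
    (hl : ((a :: l).map Prod.fst).Nodup) {e : Sym2 (V × Bool)} (he : e ∈ edges (a :: l)) :
    a ∉ e := by
  rw [List.map_cons, List.nodup_cons] at hl
  cases l with
  | nil => simp at he
  | cons b l =>
    rw [edges_cons_cons, List.mem_cons] at he
    rcases he with rfl | he
    · intro hx
      rcases Sym2.mem_iff.1 hx with h | h
      · exact neg_ne a h.symm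
      · exact hl.1 (by simp [h])
    · exact fun h => hl.1 (fst_mem_of_mem_edges he h)

lemma neg_last_notMem_of_mem_edges {b : V × Bool} {l : List (V × Bool)}
    (hl : ((l ++ [b]).map Prod.fst).Nodup) {e : Sym2 (V × Bool)} (he : e ∈ edges (l ++ [b])) :
    neg b ∉ e := by
  induction l with
  | nil => simp at he
  | cons a l ih =>
    rw [List.cons_append, List.map_cons, List.nodup_cons] at hl
    have key : neg b ≠ neg a := by
      intro h
      apply hl.1
      rw [← neg_injective h]
      simp
    cases l with
    | nil =>
      simp only [List.cons_append, List.nil_append, edges_cons_cons, edges_singleton,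
        List.mem_singleton] at he
      subst he
      intro hx
      rcases Sym2.mem_iff.1 hx with h | h
      · exact key h
      · exact neg_ne b h
    | cons c l =>
      simp only [List.cons_append, edges_cons_cons, List.mem_cons] at he
      rcases he with rfl | he
      · intro hx
        rcases Sym2.mem_iff.1 hx with h | h
        · exact key h
        · have h2 := hl.2
          simp only [List.cons_append, List.map_cons, List.nodup_cons] at h2
          apply h2.1
          rw [← h]
          simp
      · exact ih hl.2 he

/-- The total assignment `σ` satisfies the clauses in `𝒞` and the literals in `A`. -/
def SatBy (σ : V → Bool) (𝒞 : Finset (Sym2 (V × Bool))) (A : Set (V × Bool)) : Prop :=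
  (∀ c ∈ 𝒞, ∃ x ∈ c, σ x.1 = x.2) ∧ ∀ x ∈ A, σ x.1 = x.2

/-- `𝒞` is minimal among the sets of clauses that are unsatisfiable together with `A`. -/
def MinUnsat (𝒞 : Finset (Sym2 (V × Bool))) (A : Set (V × Bool)) : Prop :=
  (∀ σ, ¬ SatBy σ 𝒞 A) ∧ ∀ 𝒟 ⊂ 𝒞, ∃ σ, SatBy σ 𝒟 A

lemma exists_minUnsat {𝒞 : Finset (Sym2 (V × Bool))} {A : Set (V × Bool)}
    (h : ∀ σ, ¬ SatBy σ 𝒞 A) : ∃ 𝒟 ⊆ 𝒞, MinUnsat 𝒟 A := by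
  induction 𝒞 using Finset.strongInduction with
  | H 𝒞 ih =>
    by_cases hm : ∀ 𝒟 ⊂ 𝒞, ∃ σ, SatBy σ 𝒟 A
    · exact ⟨𝒞, subset_rfl, h, hm⟩
    · push Not at hm
      obtain ⟨𝒟, hD, hs⟩ := hm
      obtain ⟨ℰ, hE, hmin⟩ := ih 𝒟 hD hs
      exact ⟨ℰ, hE.trans hD.subset, hmin⟩

/-- A minimal unsatisfiable formula has no autarky. -/
lemma MinUnsat.exists_violated {𝒞 : Finset (Sym2 (V × Bool))} {A T : Set (V × Bool)}
    (h : MinUnsat 𝒞 A) (hT : ∀ x ∈ T, neg x ∉ T) {c₀ : Sym2 (V × Bool)} (hc₀ : c₀ ∈ 𝒞)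
    {x₀ : V × Bool} (hx₀ : x₀ ∈ c₀) (hx₀T : x₀ ∈ T) :
    ∃ x ∈ T, neg x ∈ A ∨ ∃ c ∈ 𝒞, neg x ∈ c ∧ ∀ y ∈ c, y ∉ T := by
  classical
  by_contra hcon
  push Not at hcon
  obtain ⟨σ, hσ, hσA⟩ := h.2 (𝒞.erase c₀) (Finset.erase_ssubset hc₀)
  let τ : V → Bool := fun v => if (v, true) ∈ T then true else if (v, false) ∈ T then false else σ v
  have h1 : ∀ x ∈ T, τ x.1 = x.2 := by
    rintro ⟨v, b⟩ hx
    have := hT _ hx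
    cases b <;> simp_all [τ, neg]
  have h2 : ∀ x, σ x.1 = x.2 → neg x ∉ T → τ x.1 = x.2 := by
    rintro ⟨v, b⟩ hx hn
    cases b <;> simp_all [τ, neg]
  refine h.1 τ ⟨fun c hc => ?_, fun x hx => ?_⟩
  · by_cases hcT : ∃ x ∈ c, x ∈ T
    · obtain ⟨x, hxc, hxT⟩ := hcT
      exact ⟨x, hxc, h1 x hxT⟩
    · have hne : c ≠ c₀ := by
        rintro rfl
        exact hcT ⟨x₀, hx₀, hx₀T⟩
      obtain ⟨x, hxc, hx⟩ := hσ c (Finset.mem_erase.2 ⟨hne, hc⟩)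
      refine ⟨x, hxc, h2 x hx fun hn => hcT ?_⟩
      exact (hcon _ hn).2 c hc (by simpa using hxc)
  · refine h2 x (hσA x hx) fun hn => (hcon _ hn).1 (by simpa using hx)

/-- A list of literals on distinct variables, each implying the next by a clause of `𝒞`. -/
def IsPath (𝒞 : Finset (Sym2 (V × Bool))) (l : List (V × Bool)) : Prop :=
  (l.map Prod.fst).Nodup ∧ ∀ e ∈ edges l, e ∈ 𝒞

/-- The clause closing one end of a path, where `none` stands for a unit clause. -/
def hook (a : V × Bool) (L : Option (V × Bool)) : List (Sym2 (V × Bool)) :=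
  (L.map fun u => s(a, u)).toList

/-- The clauses of a path with hooks at its two ends. -/
def bicycle (a : V × Bool) (l : List (V × Bool)) (b : V × Bool) (L R : Option (V × Bool)) :
    List (Sym2 (V × Bool)) :=
  edges (a :: (l ++ [b])) ++ (hook a L ++ hook (neg b) R)

lemma exists_longest_path [Fintype V] {𝒞 : Finset (Sym2 (V × Bool))} {l₀ : List (V × Bool)}
    (h₀ : IsPath 𝒞 l₀) :
    ∃ l, IsPath 𝒞 l ∧ l₀.length ≤ l.length ∧ ∀ l', IsPath 𝒞 l' → l'.length ≤ l.length := by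
  classical
  have hb : ∀ l, IsPath 𝒞 l → l.length ≤ Fintype.card V := fun l hl => by
    simpa using hl.1.length_le_card
  let P : ℕ → Prop := fun k => ∃ l, IsPath 𝒞 l ∧ l.length = k
  obtain ⟨l, hl, hlen⟩ : P (Nat.findGreatest P (Fintype.card V)) :=
    Nat.findGreatest_spec (hb l₀ h₀) ⟨l₀, h₀, rfl⟩
  have hmax : ∀ l', IsPath 𝒞 l' → l'.length ≤ l.length := fun l' hl' => by
    rw [hlen]
    exact Nat.le_findGreatest (hb l' hl') ⟨l', hl', rfl⟩
  exact ⟨l, hl, hmax l₀ h₀, hmax⟩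

lemma nodup_bicycle {a b : V × Bool} {l : List (V × Bool)} {L R : Option (V × Bool)}
    (hl : ((a :: (l ++ [b])).map Prod.fst).Nodup)
    (hLR : ∀ u ∈ L, ∀ v ∈ R, s(a, u) ≠ s(neg b, v)) : (bicycle a l b L R).Nodup := by
  have hLe : ∀ e ∈ hook a L, e ∉ edges (a :: (l ++ [b])) := by
    intro e he he'
    obtain ⟨u, -, rfl⟩ : ∃ u, L = some u ∧ s(a, u) = e := by simpa [hook] using he
    exact head_notMem_of_mem_edges hl he' (Sym2.mem_mk_left _ _)
  have hRe : ∀ e ∈ hook (neg b) R, e ∉ edges (a :: (l ++ [b])) := by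
    intro e he he'
    obtain ⟨u, -, rfl⟩ : ∃ u, R = some u ∧ s(neg b, u) = e := by simpa [hook] using he
    exact neg_last_notMem_of_mem_edges (l := a :: l) (by simpa using hl) he' (Sym2.mem_mk_left _ _)
  rw [bicycle, List.nodup_append']
  refine ⟨nodup_edges hl, ?_, ?_⟩
  · rcases L with _ | u <;> rcases R with _ | v <;> simp_all [hook]
  · intro e he he'
    rcases List.mem_append.1 he' with h | h
    · exact hLe e h he
    · exact hRe e h he

lemma mem_of_mem_bicycle {𝒞 : Finset (Sym2 (V × Bool))} {a b : V × Bool} {l : List (V × Bool)}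
    {L R : Option (V × Bool)} (hl : IsPath 𝒞 (a :: (l ++ [b]))) (hL : ∀ u ∈ L, s(a, u) ∈ 𝒞)
    (hR : ∀ v ∈ R, s(neg b, v) ∈ 𝒞) : ∀ e ∈ bicycle a l b L R, e ∈ 𝒞 := by
  intro e he
  rcases List.mem_append.1 he with h | h
  · exact hl.2 e h
  · rcases List.mem_append.1 h with h | h
    · obtain ⟨u, hu, rfl⟩ : ∃ u, L = some u ∧ s(a, u) = e := by simpa [hook] using h
      exact hL u hu
    · obtain ⟨u, hu, rfl⟩ : ∃ u, R = some u ∧ s(neg b, u) = e := by simpa [hook] using h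
      exact hR u hu

lemma fst_mem_of_longest_right {𝒞 : Finset (Sym2 (V × Bool))} {l : List (V × Bool)}
    {b v : V × Bool} (hl : IsPath 𝒞 (l ++ [b]))
    (hmax : ∀ l', IsPath 𝒞 l' → l'.length ≤ (l ++ [b]).length) (hv : s(neg b, v) ∈ 𝒞) :
    v.1 ∈ (l ++ [b]).map Prod.fst := by
  by_contra hn
  have : IsPath 𝒞 ((l ++ [b]) ++ [v]) := by
    refine ⟨?_, fun e he => ?_⟩
    · rw [List.map_append, List.nodup_append']
      refine ⟨hl.1, by simp, ?_⟩
      intro x hx hx'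
      simp only [List.map_cons, List.map_nil, List.mem_singleton] at hx'
      exact hn (hx' ▸ hx)
    · rw [edges_append] at he
      simp only [edges_singleton, List.mem_append, List.mem_singleton] at he
      rcases he with he | rfl
      · exact hl.2 e he
      · exact hv
  have := hmax _ this
  simp at this

lemma fst_mem_of_longest_left {𝒞 : Finset (Sym2 (V × Bool))} {l : List (V × Bool)}
    {a u : V × Bool} (hl : IsPath 𝒞 (a :: l))
    (hmax : ∀ l', IsPath 𝒞 l' → l'.length ≤ (a :: l).length) (hu : s(a, u) ∈ 𝒞) :
    u.1 ∈ (a :: l).map Prod.fst := by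
  by_contra hn
  have : IsPath 𝒞 (neg u :: a :: l) := by
    refine ⟨?_, fun e he => ?_⟩
    · rw [List.map_cons, List.nodup_cons]
      exact ⟨hn, hl.1⟩
    · rw [edges_cons_cons, List.mem_cons] at he
      rcases he with rfl | he
      · rwa [neg_neg, Sym2.eq_swap]
      · exact hl.2 e he
  have := hmax _ this
  simp at this

/-- An end of a path in a minimal unsatisfiable formula is a unit clause or can be continued. -/
lemma MinUnsat.exists_end {𝒞 : Finset (Sym2 (V × Bool))} {A : Set (V × Bool)}
    (h : MinUnsat 𝒞 A) {x : V × Bool} {c₀ : Sym2 (V × Bool)} (hc₀ : c₀ ∈ 𝒞) (hx : x ∈ c₀) :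
    ∃ L : Option (V × Bool), (L = none → neg x ∈ A) ∧ ∀ u ∈ L, s(neg x, u) ∈ 𝒞 := by
  obtain ⟨y, rfl, hy | ⟨c, hc, hyc, -⟩⟩ := h.exists_violated (T := {x})
    (by rintro y rfl; exact neg_ne y) hc₀ hx rfl
  · exact ⟨none, fun _ => hy, by simp⟩
  · obtain ⟨u, rfl⟩ := hyc
    exact ⟨some u, by simp, by simpa using hc⟩

/-- A 2-CNF that is unsatisfiable together with the unit clauses in `A` contains a path both of
whose ends are unit clauses or hooked back to the path by further clauses. -/
theorem exists_bicycle [Fintype V] {𝒞 : Finset (Sym2 (V × Bool))} {A : Set (V × Bool)}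
    (hd : ∀ a b, s(a, b) ∈ 𝒞 → a.1 ≠ b.1) (hA : ∃ σ : V → Bool, ∀ x ∈ A, σ x.1 = x.2)
    (hun : ∀ σ, ¬ SatBy σ 𝒞 A) :
    ∃ (a : V × Bool) (l : List (V × Bool)) (b : V × Bool) (L R : Option (V × Bool)),
      (a :: (l ++ [b])).length ≤ Fintype.card V ∧
      (L = none → a ∈ A) ∧ (∀ u ∈ L, u.1 ∈ (a :: (l ++ [b])).map Prod.fst) ∧
      (R = none → neg b ∈ A) ∧ (∀ u ∈ R, u.1 ∈ (a :: (l ++ [b])).map Prod.fst) ∧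
      (bicycle a l b L R).Nodup ∧ ∀ e ∈ bicycle a l b L R, e ∈ 𝒞 := by
  obtain ⟨𝒟, hsub, hmin⟩ := exists_minUnsat hun
  replace hd : ∀ a b, s(a, b) ∈ 𝒟 → a.1 ≠ b.1 := fun a b h => hd a b (hsub h)
  suffices H : ∃ (a : V × Bool) (l : List (V × Bool)) (b : V × Bool) (L R : Option (V × Bool)),
      (IsPath 𝒟 (a :: (l ++ [b])) ∧ ∀ l', IsPath 𝒟 l' → l'.length ≤ (a :: (l ++ [b])).length) ∧
      (L = none → a ∈ A) ∧ (∀ u ∈ L, s(a, u) ∈ 𝒟) ∧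
      (R = none → neg b ∈ A) ∧ (∀ u ∈ R, s(neg b, u) ∈ 𝒟) ∧
      (∀ u ∈ L, ∀ v ∈ R, s(a, u) ≠ s(neg b, v)) by
    obtain ⟨a, l, b, L, R, ⟨hl, hmax⟩, hLA, hL, hRA, hR, hLR⟩ := H
    refine ⟨a, l, b, L, R, ?_, hLA, fun u hu => ?_, hRA, fun v hv => ?_,
      nodup_bicycle hl.1 hLR, fun e he => hsub (mem_of_mem_bicycle hl hL hR e he)⟩
    · simpa using hl.1.length_le_card
    · exact fst_mem_of_longest_left hl hmax (hL u hu)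
    · exact fst_mem_of_longest_right (l := a :: l) hl hmax (hR v hv)
  have hne : 𝒟.Nonempty := by
    rw [Finset.nonempty_iff_ne_empty]
    rintro rfl
    obtain ⟨σ, hσ⟩ := hA
    exact hmin.1 σ ⟨by simp, hσ⟩
  obtain ⟨c₀, hc₀⟩ := hne
  obtain ⟨l, hl, hlen, hmax⟩ : ∃ l, IsPath 𝒟 l ∧ 2 ≤ l.length ∧
      ∀ l', IsPath 𝒟 l' → l'.length ≤ l.length := by
    induction c₀ with
    | h x y =>
      apply exists_longest_path (l₀ := [neg x, y])
      exact ⟨by simpa using hd x y hc₀, by simpa [edges_cons_cons] using hc₀⟩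
  obtain ⟨a, l, b, rfl⟩ : ∃ a l' b, l = a :: (l' ++ [b]) := by
    rcases l with _ | ⟨a, l⟩
    · simp at hlen
    · rcases List.eq_nil_or_concat l with rfl | ⟨l', b, rfl⟩
      · simp at hlen
      · exact ⟨a, l', b, by simp⟩
  have hab : a.1 ≠ b.1 := by
    have := hl.1
    simp only [List.map_cons, List.nodup_cons] at this
    intro h
    exact this.1 (by simp [h])
  by_cases hcyc : s(a, neg b) ∈ 𝒟
  · obtain ⟨x, hxT, hx⟩ := hmin.exists_violated (T := {x | x ∈ a :: (l ++ [b])}) (by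
      intro x hx hx'
      exact neg_ne x (List.inj_on_of_nodup_map hl.1 hx' hx rfl)) hcyc (Sym2.mem_mk_left _ _)
      (by simp)
    -- rotate the cycle so that `x` becomes the last literal
    obtain ⟨a', l', hl', hperm, hL⟩ : ∃ a' l', IsPath 𝒟 (a' :: (l' ++ [x])) ∧
        (a' :: (l' ++ [x])).Perm (a :: (l ++ [b])) ∧ s(a', neg x) ∈ 𝒟 := by
      obtain ⟨l₁, l₂, hsplit⟩ := List.append_of_mem hxT
      rcases l₂ with _ | ⟨a', q⟩
      · obtain ⟨h1, h2⟩ : a :: l = l₁ ∧ b = x := by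
          have : (a :: l) ++ [b] = l₁ ++ [x] := by simpa using hsplit
          simpa using List.append_inj' this rfl
        subst h1 h2
        exact ⟨a, l, hl, List.Perm.refl _, hcyc⟩
      · obtain ⟨p, hp⟩ : ∃ p, l₁ ++ [x] = a :: p := by
          rcases l₁ with _ | ⟨z, l₁⟩
          · exact ⟨[], by simpa using (List.cons.inj hsplit).1.symm⟩
          · exact ⟨l₁ ++ [x], by simpa using (List.cons.inj hsplit).1.symm⟩
        obtain ⟨r, hr⟩ : ∃ r, a' :: q = r ++ [b] := by
          rcases List.eq_nil_or_concat (a' :: q) with h | ⟨r, z, h⟩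
          · simp at h
          · refine ⟨r, ?_⟩
            have : (a :: l) ++ [b] = (l₁ ++ x :: r) ++ [z] := by simpa [h] using hsplit
            have := (List.append_inj' this rfl).2
            simp_all
        have hsplit' : a :: (l ++ [b]) = (l₁ ++ [x]) ++ (a' :: q) := by simpa using hsplit
        have hperm : ((a' :: q) ++ (l₁ ++ [x])).Perm (a :: (l ++ [b])) :=
          hsplit' ▸ List.perm_append_comm
        have hedges := hl.2
        rw [hsplit', edges_append] at hedges
        refine ⟨a', q ++ l₁, ⟨?_, fun e he => ?_⟩, by simpa using hperm, ?_⟩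
        · exact ((by simpa using hperm : (a' :: (q ++ l₁ ++ [x])).Perm
            (a :: (l ++ [b]))).map Prod.fst).nodup_iff.2 hl.1
        · have heq : a' :: (q ++ l₁ ++ [x]) = (r ++ [b]) ++ (a :: p) := by
            rw [← hr, ← hp]
            simp
          rw [heq, edges_append, ← hr, ← hp, List.mem_append, List.mem_cons] at he
          rcases he with he | rfl | he
          · exact hedges e (by simp [he])
          · rwa [Sym2.eq_swap]
          · exact hedges e (by simp [he])
        · rw [Sym2.eq_swap]
          exact hedges _ (by simp)
    have hlen' := hperm.length_eq
    have hR : ∃ R : Option (V × Bool), (R = none → neg x ∈ A) ∧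
        ∀ u ∈ R, s(neg x, u) ∈ 𝒟 ∧ a' ∉ s(neg x, u) := by
      rcases hx with hx | ⟨c, hc, ⟨u, rfl⟩, hcT⟩
      · exact ⟨none, fun _ => hx, by simp⟩
      · refine ⟨some u, by simp, ?_⟩
        rintro _ ⟨⟩
        exact ⟨hc, fun h => hcT _ h (hperm.subset (by simp))⟩
    obtain ⟨R, hRA, hR⟩ := hR
    refine ⟨a', l', x, some (neg x), R, ⟨hl', fun l'' h => hlen' ▸ hmax l'' h⟩, by simp,
      by simpa using hL, hRA, fun u hu => (hR u hu).1, fun u _ v hv h => (hR v hv).2 ?_⟩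
    rw [← h]
    exact Sym2.mem_mk_left _ _
  · have hfirst : ∃ c ∈ 𝒟, neg a ∈ c := by
      rcases l with _ | ⟨y, l⟩ <;>
      exact ⟨_, hl.2 _ List.mem_cons_self, Sym2.mem_mk_left _ _⟩
    have hlast : ∃ c ∈ 𝒟, b ∈ c := by
      rcases List.eq_nil_or_concat (a :: l) with h | ⟨l', y, h⟩
      · simp at h
      · refine ⟨s(neg y, b), hl.2 _ ?_, Sym2.mem_mk_right _ _⟩
        rw [← List.cons_append, h, List.concat_eq_append, edges_append]
        simp
    obtain ⟨c, hc, hac⟩ := hfirst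
    obtain ⟨c', hc', hbc⟩ := hlast
    obtain ⟨L, hLA, hL⟩ := hmin.exists_end hc hac
    obtain ⟨R, hRA, hR⟩ := hmin.exists_end hc' hbc
    rw [neg_neg] at hLA hL
    refine ⟨a, l, b, L, R, ⟨hl, hmax⟩, hLA, hL, hRA, hR, fun u hu v hv h => hcyc ?_⟩
    have : neg b ∈ s(a, u) := h ▸ Sym2.mem_mk_left _ _
    rcases Sym2.mem_iff.1 this with h' | h'
    · exact absurd (congrArg Prod.fst h').symm hab
    · exact h' ▸ hL u hu

end Deterministic
end TwoSat

namespace TwoSat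

section Probability

lemma pr_eq {Ω : Type*} [Fintype Ω] (P : Ω → Prop) [DecidablePred P] :
    pr Ω P = ((univ.filter P).card : ℝ) / (Fintype.card Ω : ℝ) := by
  rw [pr, Nat.card_eq_fintype_card, Fintype.card_subtype]

lemma pr_nonneg {Ω : Type*} [Fintype Ω] (P : Ω → Prop) : 0 ≤ pr Ω P := by
  rw [pr]
  positivity

lemma pr_compl {Ω : Type*} [Fintype Ω] [Nonempty Ω] (P : Ω → Prop) :
    pr Ω P = 1 - pr Ω (fun ω => ¬ P ω) := by
  classical
  have h0 : (Fintype.card Ω : ℝ) ≠ 0 := by exact_mod_cast Fintype.card_ne_zero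
  have h := Finset.card_filter_add_card_filter_not (s := (univ : Finset Ω)) P
  rw [Finset.card_univ] at h
  rw [pr_eq, pr_eq, eq_sub_iff_add_eq, ← add_div, div_eq_one_iff_eq h0]
  exact_mod_cast h

lemma pr_le_one {Ω : Type*} [Fintype Ω] [Nonempty Ω] (P : Ω → Prop) : pr Ω P ≤ 1 := by
  linarith [pr_compl P, pr_nonneg fun ω => ¬ P ω]

lemma pr_le_sum {Ω ι : Type*} [Fintype Ω] (S : Finset ι) {P : Ω → Prop} {Q : ι → Ω → Prop}
    (h : ∀ ω, P ω → ∃ j ∈ S, Q j ω) : pr Ω P ≤ ∑ j ∈ S, pr Ω (Q j) := by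
  classical
  simp only [pr_eq, ← Finset.sum_div]
  gcongr
  have : univ.filter P ⊆ S.biUnion fun j => univ.filter (Q j) := by
    intro ω hω
    simpa using h ω (by simpa using hω)
  exact_mod_cast (Finset.card_le_card this).trans Finset.card_biUnion_le

/-- Fubini and Markov's inequality: if `R` fails with probability at most `B` for every fixed
second argument, then for most first arguments `R` holds with probability at least `1 - ε`. -/
lemma one_sub_div_le_pr {Ω Λ : Type*} [Fintype Ω] [Fintype Λ] [Nonempty Ω] [Nonempty Λ]
    (R : Ω → Λ → Prop) {B ε : ℝ} (hε : 0 < ε) (hB : ∀ α, pr Ω (fun G => ¬ R G α) ≤ B) :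
    1 - B / ε ≤ pr Ω (fun G => 1 - ε ≤ pr Λ (R G)) := by
  classical
  have hΩ : (0 : ℝ) < Fintype.card Ω := by exact_mod_cast Fintype.card_pos
  have hΛ : (0 : ℝ) < Fintype.card Λ := by exact_mod_cast Fintype.card_pos
  rw [pr_compl]
  suffices pr Ω (fun G => ¬ 1 - ε ≤ pr Λ (R G)) ≤ B / ε by linarith
  set bad : Finset Ω := univ.filter fun G => ¬ 1 - ε ≤ pr Λ (R G) with hbad
  rw [pr_eq, le_div_iff₀ hε, div_mul_eq_mul_div, div_le_iff₀ hΩ]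
  have h1 : ∀ G ∈ bad, ε * Fintype.card Λ ≤ ((univ.filter fun α => ¬ R G α).card : ℝ) := by
    intro G hG
    have hG' : ¬ 1 - ε ≤ pr Λ (R G) := by simpa [hbad] using hG
    rw [pr_compl, pr_eq] at hG'
    rw [← le_div_iff₀ hΛ]
    linarith
  have h2 : ∀ α, ((univ.filter fun G => ¬ R G α).card : ℝ) ≤ B * Fintype.card Ω := by
    intro α
    have := hB α
    rwa [pr_eq, div_le_iff₀ hΩ] at this
  have h3 : ∑ G, ((univ.filter fun α => ¬ R G α).card : ℝ) =
      ∑ α, ((univ.filter fun G => ¬ R G α).card : ℝ) := by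
    exact_mod_cast Finset.sum_card_bipartiteAbove_eq_sum_card_bipartiteBelow
      (s := (univ : Finset Ω)) (t := (univ : Finset Λ)) (fun G α => ¬ R G α)
  have h4 : (bad.card : ℝ) * (ε * Fintype.card Λ) ≤
      ∑ G, ((univ.filter fun α => ¬ R G α).card : ℝ) := by
    calc (bad.card : ℝ) * (ε * Fintype.card Λ) = ∑ G ∈ bad, ε * (Fintype.card Λ : ℝ) := by simp
      _ ≤ ∑ G ∈ bad, ((univ.filter fun α => ¬ R G α).card : ℝ) := Finset.sum_le_sum h1
      _ ≤ _ := Finset.sum_le_sum_of_subset_of_nonneg (subset_univ _) fun _ _ _ => by positivity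
  have h5 : ∑ α, ((univ.filter fun G => ¬ R G α).card : ℝ) ≤
      Fintype.card Λ * (B * Fintype.card Ω) := by
    calc _ ≤ ∑ _α : Λ, B * (Fintype.card Ω : ℝ) := Finset.sum_le_sum fun α _ => h2 α
      _ = _ := by simp
  refine le_of_mul_le_mul_right ?_ hΛ
  linarith

/-- A list of distinct values occurs among `m` uniform samples with probability at most
`(m / N) ^ r`, where `r` is its length. -/
lemma pr_forall_mem_le {X Y : Type*} [Fintype X] [Nonempty X] {f : X → Y}
    (hf : Function.Injective f) (m : ℕ) {D : List Y} (hD : D.Nodup) :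
    pr (Fin m → X) (fun G => ∀ d ∈ D, ∃ i, f (G i) = d) ≤
      ((m : ℝ) / Fintype.card X) ^ D.length := by
  classical
  have hX : (0 : ℝ) < Fintype.card X := by exact_mod_cast Fintype.card_pos
  have h1 : pr (Fin m → X) (fun G => ∀ d ∈ D, ∃ i, f (G i) = d) ≤
      ∑ e ∈ univ.filter (fun e : Fin D.length → Fin m => Function.Injective e),
        pr (Fin m → X) (fun G => ∀ t, f (G (e t)) = D.get t) := by
    refine pr_le_sum _ fun G hG => ?_
    choose e he using fun t : Fin D.length => hG (D.get t) (D.get_mem t)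
    refine ⟨e, ?_, he⟩
    simp only [Finset.mem_filter, Finset.mem_univ, true_and]
    intro s t hst
    exact (List.nodup_iff_injective_get.1 hD) (by rw [← he s, ← he t, hst])
  have h2 : ∀ e ∈ univ.filter (fun e : Fin D.length → Fin m => Function.Injective e),
      pr (Fin m → X) (fun G => ∀ t, f (G (e t)) = D.get t) ≤
        (1 / (Fintype.card X : ℝ)) ^ D.length := by
    intro e he
    have he : Function.Injective e := by simpa using he
    let S : Fin m → Finset X := fun i => univ.filter fun x => ∀ t, e t = i → f x = D.get t
    have hS : univ.filter (fun G : Fin m → X => ∀ t, f (G (e t)) = D.get t) ⊆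
        Fintype.piFinset S := by
      intro G hG
      have hG : ∀ t, f (G (e t)) = D.get t := by simpa using hG
      simp only [Fintype.mem_piFinset, S, Finset.mem_filter, Finset.mem_univ, true_and]
      rintro _ t rfl
      exact hG t
    have hcard : ∀ i, ((S i).card : ℝ) ≤
        (Fintype.card X : ℝ) * if i ∈ univ.image e then 1 / (Fintype.card X : ℝ) else 1 := by
      intro i
      split_ifs with hi
      · obtain ⟨t, -, rfl⟩ := Finset.mem_image.1 hi
        rw [mul_one_div_cancel hX.ne']
        have : (S (e t)).card ≤ 1 := by
          rw [Finset.card_le_one]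
          intro x hx y hy
          simp only [S, Finset.mem_filter, Finset.mem_univ, true_and] at hx hy
          exact hf ((hx t rfl).trans (hy t rfl).symm)
        exact_mod_cast this
      · rw [mul_one]
        exact_mod_cast Finset.card_le_univ _
    rw [pr_eq, div_le_iff₀ (by exact_mod_cast Fintype.card_pos)]
    calc ((univ.filter fun G : Fin m → X => ∀ t, f (G (e t)) = D.get t).card : ℝ)
        ≤ ((Fintype.piFinset S).card : ℝ) := by exact_mod_cast Finset.card_le_card hS
      _ = ∏ i, ((S i).card : ℝ) := by rw [Fintype.card_piFinset, Nat.cast_prod]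
      _ ≤ ∏ i, ((Fintype.card X : ℝ) *
            if i ∈ univ.image e then 1 / (Fintype.card X : ℝ) else 1) :=
          Finset.prod_le_prod (fun _ _ => by positivity) fun i _ => hcard i
      _ = _ := by
          rw [Finset.prod_mul_distrib, Finset.prod_ite_mem, Finset.univ_inter,
            Finset.prod_const, Finset.prod_const, Finset.card_image_of_injective _ he]
          simp [mul_comm]
  refine h1.trans ((Finset.sum_le_sum h2).trans ?_)
  rw [Finset.sum_const, nsmul_eq_mul, div_eq_mul_one_div (m : ℝ), mul_pow]
  refine mul_le_mul_of_nonneg_right ?_ (by positivity)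
  have := Finset.card_filter_le (univ : Finset (Fin D.length → Fin m))
    (fun e => Function.Injective e)
  rw [Finset.card_univ, Fintype.card_fun, Fintype.card_fin, Fintype.card_fin] at this
  exact_mod_cast this

/-- The unordered pair of literals of a clause. -/
def lits {n : ℕ} (C : Clause n) : Sym2 (Fin n × Bool) := s(C.val.1, C.val.2)

lemma lits_injective (n : ℕ) : Function.Injective (lits (n := n)) := by
  rintro ⟨⟨a, b⟩, hab⟩ ⟨⟨c, d⟩, hcd⟩ h
  rcases Sym2.eq_iff.1 h with ⟨h1, h2⟩ | ⟨h1, h2⟩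
  · simp only at h1 h2
    subst h1 h2
    rfl
  · simp only at h1 h2 hab hcd
    subst h1 h2
    exact absurd hab hcd.asymm

lemma fst_ne_of_lits_eq {n : ℕ} {C : Clause n} {a b : Fin n × Bool} (h : lits C = s(a, b)) :
    a.1 ≠ b.1 := by
  rcases Sym2.eq_iff.1 h with ⟨h1, h2⟩ | ⟨h1, h2⟩
  · rw [← h1, ← h2]
    exact C.2.ne
  · rw [← h1, ← h2]
    exact C.2.ne'

lemma litVal_eq_true {n : ℕ} (σ : Fin n → Bool) (x : Fin n × Bool) :
    litVal σ x = true ↔ σ x.1 = x.2 := by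
  rcases x with ⟨v, b⟩
  cases b <;> simp [litVal]

lemma clauseSat_iff {n : ℕ} (σ : Fin n → Bool) (C : Clause n) :
    clauseSat σ C ↔ ∃ x ∈ lits C, σ x.1 = x.2 := by
  simp [clauseSat, lits, litVal_eq_true]

lemma card_clause (n : ℕ) : (Fintype.card (Clause n) : ℝ) = 2 * n * (n - 1) := by
  have h1 : Fintype.card (Clause n) =
      (univ.filter fun p : (Fin n × Bool) × (Fin n × Bool) => p.1.1 < p.2.1).card := by
    rw [Fintype.card_subtype]
  have h2 : (univ.filter fun p : (Fin n × Bool) × (Fin n × Bool) => p.2.1 < p.1.1).card =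
      Fintype.card (Clause n) := by
    rw [h1]
    exact Finset.card_bij' (fun p _ => p.swap) (fun p _ => p.swap) (by simp) (by simp)
      (by simp) (by simp)
  have h3 : (univ.filter fun p : (Fin n × Bool) × (Fin n × Bool) => p.1.1 = p.2.1).card =
      4 * n := by
    have : (univ : Finset (Fin n × Bool × Bool)).card = 4 * n := by
      simp [mul_comm]
    rw [← this]
    refine Finset.card_bij' (fun p _ => (p.1.1, p.1.2, p.2.2))
      (fun q _ => ((q.1, q.2.1), (q.1, q.2.2))) (by simp) (by simp) ?_ (by simp)
    rintro ⟨⟨v, b⟩, ⟨w, c⟩⟩ h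
    simp at h
    simp [h]
  have h4 : (univ.filter fun p : (Fin n × Bool) × (Fin n × Bool) => p.1.1 < p.2.1).card +
      (univ.filter fun p : (Fin n × Bool) × (Fin n × Bool) => p.2.1 < p.1.1).card +
      (univ.filter fun p : (Fin n × Bool) × (Fin n × Bool) => p.1.1 = p.2.1).card =
      (2 * n) * (2 * n) := by
    have : (univ : Finset ((Fin n × Bool) × (Fin n × Bool))).card = (2 * n) * (2 * n) := by
      simp [mul_comm]
    rw [← this, Finset.card_filter, Finset.card_filter, Finset.card_filter,
      ← Finset.sum_add_distrib, ← Finset.sum_add_distrib, Finset.card_eq_sum_ones]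
    refine Finset.sum_congr rfl fun p _ => ?_
    rcases lt_trichotomy p.1.1 p.2.1 with h | h | h
    · simp [h, h.ne, h.asymm]
    · simp [h]
    · simp [h, h.ne', h.asymm]
  rw [← h1, h2, h3] at h4
  have h5 : (Fintype.card (Clause n) : ℝ) + Fintype.card (Clause n) + 4 * n =
      (2 * n) * (2 * n) := by exact_mod_cast h4
  linarith

/-- The literals made true by a partial assignment. -/
def trueLits {n : ℕ} (α : PAssign n) : Set (Fin n × Bool) := {x | α x.1 = some x.2}

open Classical in
lemma sum_trueLits_le {n : ℕ} (α : PAssign n) :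
    ∑ x, (if x ∈ trueLits α then (1 : ℝ) else 0) ≤ (support α).card := by
  rw [Finset.sum_boole]
  have : (univ.filter fun x => x ∈ trueLits α).card ≤ (support α).card := by
    refine Finset.card_le_card_of_injOn Prod.fst ?_ ?_
    · intro x hx
      have hx : α x.1 = some x.2 := (Finset.mem_filter.1 (Finset.mem_coe.1 hx)).2
      simp [support, hx]
    · intro x hx y hy hxy
      have hx : α x.1 = some x.2 := (Finset.mem_filter.1 (Finset.mem_coe.1 hx)).2
      have hy : α y.1 = some y.2 := (Finset.mem_filter.1 (Finset.mem_coe.1 hy)).2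
      refine Prod.ext hxy (Option.some_injective _ ?_)
      rw [← hx, ← hy, hxy]
  exact_mod_cast this

/-- Admissible ends of a path on the variables `vs`: a unit clause or a hook into `vs`. -/
def IsEnd {V : Type*} (A : Set (V × Bool)) (vs : List V) (a : V × Bool) (L : Option (V × Bool)) :
    Prop :=
  (L = none → a ∈ A) ∧ ∀ u ∈ L, u.1 ∈ vs

open Classical in
lemma sum_isEnd_le {V : Type*} [Fintype V] (A : Set (V × Bool)) (vs : List V) (a : V × Bool)
    {q : ℝ} (hq : 0 ≤ q) :
    ∑ L, (if IsEnd A vs a L then q ^ (hook a L).length else 0) ≤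
      (if a ∈ A then 1 else 0) + 2 * vs.length * q := by
  rw [Fintype.sum_option]
  refine add_le_add (by simp [IsEnd, hook]) ?_
  have h1 : ∀ u : V × Bool, (if IsEnd A vs a (some u) then q ^ (hook a (some u)).length else 0) =
      if u.1 ∈ vs.toFinset then q else 0 := by
    intro u
    simp [IsEnd, hook]
  rw [Finset.sum_congr rfl fun u _ => h1 u, Fintype.sum_prod_type_right]
  simp only [Finset.sum_ite_mem, Finset.univ_inter, Finset.sum_const, Finset.card_univ,
    Fintype.card_bool, nsmul_eq_mul]
  have := List.toFinset_card_le vs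
  have : (vs.toFinset.card : ℝ) ≤ vs.length := by exact_mod_cast this
  push_cast
  nlinarith

lemma length_bicycle {V : Type*} (a : V × Bool) (l : List (V × Bool)) (b : V × Bool)
    (L R : Option (V × Bool)) : (bicycle a l b L R).length =
      l.length + 1 + ((hook a L).length + (hook (neg b) R).length) := by
  simp [bicycle, length_edges_cons]

/-- First moment bound over bicycles, for a fixed partial assignment. -/
lemma pr_unsat_le {n : ℕ} (hn : 2 ≤ n) (m : ℕ) (α : PAssign n) {q : ℝ}
    (hq : q = m / Fintype.card (Clause n)) :
    pr (Fin m → Clause n) (fun G => ¬ ∃ σ : Fin n → Bool,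
      (∀ x b, α x = some b → σ x = b) ∧ ∀ i, clauseSat σ (G i)) ≤
      ∑ t ∈ range n, q * (2 * n * q) ^ t *
        ((support α).card + 2 * (t + 2) * (2 * n * q)) ^ 2 := by
  classical
  have hcl : Nonempty (Clause n) :=
    ⟨⟨((⟨0, by omega⟩, true), (⟨1, by omega⟩, true)), by simp⟩⟩
  have hq0 : 0 ≤ q := by rw [hq]; positivity
  set A := trueLits α with hAdef
  let path : (t : ℕ) → (Fin n × Bool) × (Fin n × Bool) × (Fin t → Fin n × Bool) →
    List (Fin n) := fun t j => (j.1 :: (List.ofFn j.2.2 ++ [j.2.1])).map Prod.fst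
  have hpath : ∀ t j, (path t j).length = t + 2 := by
    intro t j
    simp [path]
  have h1 : pr (Fin m → Clause n) (fun G => ¬ ∃ σ : Fin n → Bool,
      (∀ x b, α x = some b → σ x = b) ∧ ∀ i, clauseSat σ (G i)) ≤
      ∑ t ∈ range n, pr (Fin m → Clause n) (fun G => ∃ j L R,
        (IsEnd A (path t j) j.1 L ∧ IsEnd A (path t j) (neg j.2.1) R ∧
          (bicycle j.1 (List.ofFn j.2.2) j.2.1 L R).Nodup) ∧
        ∀ d ∈ bicycle j.1 (List.ofFn j.2.2) j.2.1 L R, ∃ i, lits (G i) = d) := by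
    refine pr_le_sum _ fun G hG => ?_
    have hd : ∀ a b, s(a, b) ∈ univ.image (fun i => lits (G i)) → a.1 ≠ b.1 := by
      intro a b h
      obtain ⟨i, -, hi⟩ := Finset.mem_image.1 h
      exact fst_ne_of_lits_eq hi
    have hA : ∃ σ : Fin n → Bool, ∀ x ∈ A, σ x.1 = x.2 := by
      refine ⟨fun v => (α v).getD true, fun x hx => ?_⟩
      have hx : α x.1 = some x.2 := hx
      simp [hx]
    have hun : ∀ σ, ¬ SatBy σ (univ.image fun i => lits (G i)) A := by
      rintro σ ⟨hσ, hσA⟩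
      refine hG ⟨σ, fun x b h => hσA (x, b) h, fun i => ?_⟩
      rw [clauseSat_iff]
      exact hσ _ (Finset.mem_image_of_mem _ (mem_univ i))
    obtain ⟨a, l, b, L, R, hlen, hLA, hL, hRA, hR, hnd, hmem⟩ :=
      exists_bicycle hd hA hun
    refine ⟨l.length, ?_, (a, b, l.get), L, R, ⟨⟨hLA, ?_⟩, ⟨hRA, ?_⟩, ?_⟩, ?_⟩
    · simp at hlen
      rw [Finset.mem_range]
      omega
    · simpa only [path, List.ofFn_get] using hL
    · simpa only [path, List.ofFn_get] using hR
    · simpa only [List.ofFn_get] using hnd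
    · simpa using hmem
  refine h1.trans (Finset.sum_le_sum fun t _ => ?_)
  set c : ℝ := 2 * (t + 2 : ℕ) * q with hc
  let wL : (Fin n × Bool) → List (Fin n) → Option (Fin n × Bool) → ℝ := fun a vs L =>
    if IsEnd A vs a L then q ^ (hook a L).length else 0
  have hwL : ∀ a vs L, 0 ≤ wL a vs L := by
    intro a vs L
    simp only [wL]
    split_ifs <;> positivity
  have h2 : pr (Fin m → Clause n) (fun G => ∃ j L R,
        (IsEnd A (path t j) j.1 L ∧ IsEnd A (path t j) (neg j.2.1) R ∧
          (bicycle j.1 (List.ofFn j.2.2) j.2.1 L R).Nodup) ∧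
        ∀ d ∈ bicycle j.1 (List.ofFn j.2.2) j.2.1 L R, ∃ i, lits (G i) = d) ≤
      ∑ j, ∑ L, ∑ R, q ^ (t + 1) * (wL j.1 (path t j) L * wL (neg j.2.1) (path t j) R) := by
    refine (pr_le_sum univ fun G ⟨j, hj⟩ => ⟨j, mem_univ _, hj⟩).trans
      (Finset.sum_le_sum fun j _ => ?_)
    refine (pr_le_sum univ fun G ⟨L, hL⟩ => ⟨L, mem_univ _, hL⟩).trans
      (Finset.sum_le_sum fun L _ => ?_)
    refine (pr_le_sum univ fun G ⟨R, hR⟩ => ⟨R, mem_univ _, hR⟩).trans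
      (Finset.sum_le_sum fun R _ => ?_)
    by_cases hv : IsEnd A (path t j) j.1 L ∧ IsEnd A (path t j) (neg j.2.1) R ∧
          (bicycle j.1 (List.ofFn j.2.2) j.2.1 L R).Nodup
    · have := pr_forall_mem_le (lits_injective n) m hv.2.2
      simp only [hv, true_and, wL, if_true, ← pow_add, and_self]
      rwa [length_bicycle, List.length_ofFn, ← hq] at this
    · have : pr (Fin m → Clause n) (fun G =>
        (IsEnd A (path t j) j.1 L ∧ IsEnd A (path t j) (neg j.2.1) R ∧
          (bicycle j.1 (List.ofFn j.2.2) j.2.1 L R).Nodup) ∧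
        ∀ d ∈ bicycle j.1 (List.ofFn j.2.2) j.2.1 L R, ∃ i, lits (G i) = d) = 0 := by
        simp [pr, hv]
      rw [this]
      exact mul_nonneg (by positivity) (mul_nonneg (hwL _ _ _) (hwL _ _ _))
  have h3 : ∀ a j, ∑ L, wL a (path t j) L ≤ (if a ∈ A then 1 else 0) + c := by
    intro a j
    have := sum_isEnd_le A (path t j) a hq0
    rwa [hpath] at this
  refine h2.trans ?_
  have hc0 : 0 ≤ c := by positivity
  calc _ = ∑ j, q ^ (t + 1) *
          ((∑ L, wL j.1 (path t j) L) * ∑ R, wL (neg j.2.1) (path t j) R) := by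
        refine Finset.sum_congr rfl fun j _ => ?_
        rw [Finset.sum_mul_sum, Finset.mul_sum]
        exact Finset.sum_congr rfl fun L _ => by rw [Finset.mul_sum]
    _ ≤ ∑ j : (Fin n × Bool) × (Fin n × Bool) × (Fin t → Fin n × Bool), q ^ (t + 1) *
          (((if j.1 ∈ A then 1 else 0) + c) * ((if neg j.2.1 ∈ A then 1 else 0) + c)) := by
        refine Finset.sum_le_sum fun j _ => ?_
        refine mul_le_mul_of_nonneg_left ?_ (by positivity)
        refine mul_le_mul (h3 _ _) (h3 _ _) (Finset.sum_nonneg fun _ _ => hwL _ _ _) ?_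
        split_ifs <;> positivity
    _ = q ^ (t + 1) * (2 * n) ^ t * ((∑ a, ((if a ∈ A then 1 else 0) + c)) *
          ∑ b, ((if neg b ∈ A then 1 else 0) + c)) := by
        rw [Finset.sum_mul_sum, Fintype.sum_prod_type, Finset.mul_sum]
        refine Finset.sum_congr rfl fun a _ => ?_
        rw [Fintype.sum_prod_type, Finset.mul_sum]
        refine Finset.sum_congr rfl fun b _ => ?_
        rw [Finset.sum_eq_card_nsmul (b := q ^ (t + 1) * (((if a ∈ A then 1 else 0) + c) *
          ((if neg b ∈ A then 1 else 0) + c))) fun _ _ => rfl]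
        simp only [Finset.card_univ, Fintype.card_fun, Fintype.card_prod,
          Fintype.card_fin, Fintype.card_bool, nsmul_eq_mul]
        push_cast
        ring
    _ = q ^ (t + 1) * (2 * n) ^ t * (∑ a, ((if a ∈ A then 1 else 0) + c)) ^ 2 := by
        rw [sq]
        congr 2
        exact Function.Bijective.sum_comp (Function.Involutive.bijective neg_neg)
          (fun b => (if b ∈ A then (1 : ℝ) else 0) + c)
    _ ≤ q ^ (t + 1) * (2 * n) ^ t * ((support α).card + 2 * (t + 2) * (2 * n * q)) ^ 2 := by
        refine mul_le_mul_of_nonneg_left (pow_le_pow_left₀ ?_ ?_ 2) (by positivity)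
        · refine Finset.sum_nonneg fun a _ => ?_
          split_ifs <;> positivity
        · rw [Finset.sum_add_distrib]
          refine add_le_add (sum_trueLits_le α) (le_of_eq ?_)
          simp [hc]
          ring
    _ = _ := by ring

end Probability

end TwoSat

namespace TwoSat

section Asymptotics

/-- The probability that a random formula is unsatisfiable together with a given partial
assignment is at most a constant times `K ^ 2 / n`, with `K` the number of assigned variables. -/
lemma exists_pr_unsat_le (δ : ℝ) (h1 : δ < 1) : ∃ S : ℝ, ∀ᶠ n : ℕ in atTop,
    ∀ m : ℕ, (m : ℝ) ≤ δ * n → ∀ K : ℕ, 1 ≤ K → ∀ α : PAssign n, (support α).card = K →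
      pr (Fin m → Clause n) (fun G => ¬ ∃ σ : Fin n → Bool,
        (∀ x b, α x = some b → σ x = b) ∧ ∀ i, clauseSat σ (G i)) ≤ S * ((K : ℝ) ^ 2 / n) := by
  obtain ⟨r, hδr, hr1⟩ := exists_between (max_lt h1 zero_lt_one)
  have hr0 : 0 < r := (le_max_right _ _).trans_lt hδr
  have hδr : δ < r := (le_max_left _ _).trans_lt hδr
  have hsum : Summable fun t : ℕ => r ^ t * (2 * (t : ℝ) + 5) ^ 2 := by
    have hr : ‖r‖ < 1 := by rwa [Real.norm_of_nonneg hr0.le]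
    have hs := (((summable_pow_mul_geometric_of_norm_lt_one 2 hr).mul_left 4).add
      ((summable_pow_mul_geometric_of_norm_lt_one 1 hr).mul_left 20)).add
      ((summable_pow_mul_geometric_of_norm_lt_one 0 hr).mul_left 25)
    refine hs.congr fun t => ?_
    ring
  refine ⟨∑' t : ℕ, r ^ t * (2 * (t : ℝ) + 5) ^ 2, ?_⟩
  have hlarge : ∀ᶠ n : ℕ in atTop, r / (r - δ) ≤ (n : ℝ) :=
    tendsto_natCast_atTop_atTop.eventually_ge_atTop _
  filter_upwards [eventually_ge_atTop 2, hlarge] with n hn hnr m hm K hK α hα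
  have hn' : (2 : ℝ) ≤ n := by exact_mod_cast hn
  have hK' : (1 : ℝ) ≤ K := by exact_mod_cast hK
  have hρ : 2 * n * ((m : ℝ) / Fintype.card (Clause n)) = m / (n - 1) := by
    rw [card_clause]
    have : (n : ℝ) - 1 ≠ 0 := by linarith
    field_simp
  have hρr : (m : ℝ) / (n - 1) ≤ r := by
    rw [div_le_iff₀ (by linarith)]
    rw [div_le_iff₀ (by linarith)] at hnr
    linarith
  have hρ0 : 0 ≤ (m : ℝ) / (n - 1) := div_nonneg (by positivity) (by linarith)
  have hq : (m : ℝ) / Fintype.card (Clause n) ≤ 1 / n := by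
    rw [le_div_iff₀ (by linarith)]
    have : (0 : ℝ) ≤ (m : ℝ) / Fintype.card (Clause n) := by positivity
    nlinarith
  refine (pr_unsat_le hn m α rfl).trans ?_
  rw [hα, hρ]
  calc _ ≤ ∑ t ∈ range n, (1 / n : ℝ) * r ^ t * (K * (2 * (t : ℝ) + 5)) ^ 2 := by
        refine Finset.sum_le_sum fun t _ => ?_
        gcongr
        have ht : (0 : ℝ) ≤ t := by positivity
        nlinarith [mul_le_mul_of_nonneg_left (hρr.trans hr1.le) (by positivity : 0 ≤ (t : ℝ) + 2)]
    _ = (∑ t ∈ range n, r ^ t * (2 * (t : ℝ) + 5) ^ 2) * ((K : ℝ) ^ 2 / n) := by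
        rw [Finset.sum_mul]
        exact Finset.sum_congr rfl fun t _ => by ring
    _ ≤ _ := by
        gcongr
        exact hsum.sum_le_tsum _ fun t _ => by positivity

lemma tendsto_sq_two_mul_ceil_rpow_div : Tendsto
    (fun n : ℕ => ((2 * ⌈(n : ℝ) ^ ((1 : ℝ) / 3)⌉₊ : ℕ) : ℝ) ^ 2 / n) atTop (nhds 0) := by
  have h0 : Tendsto (fun n : ℕ => 16 * (n : ℝ) ^ (-(1 / 3 : ℝ))) atTop (nhds 0) := by
    simpa using ((tendsto_rpow_neg_atTop (by norm_num : (0 : ℝ) < 1 / 3)).comp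
      tendsto_natCast_atTop_atTop).const_mul 16
  refine squeeze_zero' (Eventually.of_forall fun n => by positivity) ?_ h0
  filter_upwards [eventually_ge_atTop 1] with n hn
  have hn' : (1 : ℝ) ≤ n := by exact_mod_cast hn
  have h1 : (1 : ℝ) ≤ (n : ℝ) ^ ((1 : ℝ) / 3) := Real.one_le_rpow hn' (by norm_num)
  have h2 : (⌈(n : ℝ) ^ ((1 : ℝ) / 3)⌉₊ : ℝ) ≤ 2 * (n : ℝ) ^ ((1 : ℝ) / 3) := by
    linarith [Nat.ceil_lt_add_one (zero_le_one.trans h1)]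
  have h3 : ((n : ℝ) ^ ((1 : ℝ) / 3)) ^ 2 = (n : ℝ) ^ (-(1 / 3 : ℝ)) * n := by
    rw [← Real.rpow_natCast, ← Real.rpow_mul (by linarith)]
    nth_rewrite 3 [← Real.rpow_one (n : ℝ)]
    rw [← Real.rpow_add (by linarith)]
    norm_num
  rw [div_le_iff₀ (by linarith), mul_assoc, ← h3]
  push_cast
  calc (2 * (⌈(n : ℝ) ^ ((1 : ℝ) / 3)⌉₊ : ℝ)) ^ 2 ≤ (2 * (2 * (n : ℝ) ^ ((1 : ℝ) / 3))) ^ 2 := by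
        gcongr
    _ = _ := by ring

lemma nonempty_pak {n K : ℕ} (h : K ≤ n) : Nonempty (PAk n K) := by
  obtain ⟨s, -, hs⟩ := Finset.exists_subset_card_eq (s := (univ : Finset (Fin n))) (n := K)
    (by simpa using h)
  refine ⟨⟨fun x => if x ∈ s then some true else none, ?_⟩⟩
  rw [← hs]
  congr 1
  ext x
  by_cases hx : x ∈ s <;> simp [support, hx]

end Asymptotics

end TwoSat

/-- For `1/2 ≤ δ < 1`, `ε > 0`, `k = ⌈n^{1/3}⌉` and `m = ⌊δn⌋ − k`: with probability
tending to `1` over `G ∼ 𝓗₂(n,m)`, the (inner, independent) probability over a uniform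
partial assignment `α` to exactly `2k` variables that `α ∧ G` is satisfiable is at
least `1 − ε`. -/
theorem random_formula_is_good (δ ε : ℝ) (h0 : 1 / 2 ≤ δ) (h1 : δ < 1) (hε : 0 < ε) :
    Tendsto (fun n : ℕ =>
      pr (Fin (⌊δ * n⌋₊ - ⌈(n : ℝ) ^ ((1 : ℝ) / 3)⌉₊) → Clause n)
        (fun G => 1 - ε ≤
          pr (PAk n (2 * ⌈(n : ℝ) ^ ((1 : ℝ) / 3)⌉₊))
            (fun α => ∃ σ : Fin n → Bool,
              (∀ x b, α.val x = some b → σ x = b) ∧ ∀ i, clauseSat σ (G i))))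
      atTop (nhds 1) := by
  obtain ⟨S, hS⟩ := TwoSat.exists_pr_unsat_le δ h1
  have hK := TwoSat.tendsto_sq_two_mul_ceil_rpow_div
  have hlim : Tendsto (fun n : ℕ =>
      1 - S * (((2 * ⌈(n : ℝ) ^ ((1 : ℝ) / 3)⌉₊ : ℕ) : ℝ) ^ 2 / n) / ε) atTop (nhds 1) := by
    simpa using ((hK.const_mul S).div_const ε).const_sub 1
  have hsmall := hK.eventually_le_const zero_lt_one
  have hcl : ∀ n : ℕ, 2 ≤ n → Nonempty (Clause n) := fun n hn =>
    ⟨⟨((⟨0, by omega⟩, true), (⟨1, by omega⟩, true)), by simp⟩⟩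
  refine tendsto_of_tendsto_of_tendsto_of_le_of_le' hlim tendsto_const_nhds ?_ ?_
  · filter_upwards [hS, hsmall, eventually_ge_atTop 2] with n hn hn1 hn2
    have := hcl n hn2
    have hn0 : (0 : ℝ) < n := by exact_mod_cast (by omega : 0 < n)
    have hkpos : 0 < ⌈(n : ℝ) ^ ((1 : ℝ) / 3)⌉₊ := Nat.ceil_pos.2 (Real.rpow_pos_of_pos hn0 _)
    have hle : 2 * ⌈(n : ℝ) ^ ((1 : ℝ) / 3)⌉₊ ≤ n := by
      rw [div_le_one hn0] at hn1
      have : (2 * ⌈(n : ℝ) ^ ((1 : ℝ) / 3)⌉₊) ^ 2 ≤ n := by exact_mod_cast hn1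
      exact (Nat.le_self_pow two_ne_zero _).trans this
    have := TwoSat.nonempty_pak hle
    refine TwoSat.one_sub_div_le_pr _ hε
      fun α => hn _ ?_ _ (by omega) α.val α.2
    calc ((⌊δ * n⌋₊ - ⌈(n : ℝ) ^ ((1 : ℝ) / 3)⌉₊ : ℕ) : ℝ) ≤ (⌊δ * n⌋₊ : ℝ) := by
          exact_mod_cast Nat.sub_le _ _
      _ ≤ δ * n := Nat.floor_le (by positivity)
  · filter_upwards [eventually_ge_atTop 2] with n hn
    have := hcl n hn
    exact TwoSat.pr_le_one _
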